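/- Let (A,m) be a Noetherian local ring, I and J m-primary ideals, and y_1,...,y_n an A-regular sequence contained in IJ. Then for every k ≥ 1 and r, s ∈ Z, the (n−1)-st cohomology of the complex C•(n,k,r,s) is isomorphic to ((y_1^k,...,y_n^k) ∩ I^{r+nk} J^{s+nk}) / ((y_1^k,...,y_n^k) · I^{r+(n−1)k} J^{s+(n−1)k}). -/

import Mathlib

noncomputable section

namespace KirbyMehran

variable {A : Type*} [CommRing A]

/-- Powers of an ideal with integer exponents, with the convention `I^t = A` for `t ≤ 0`. -/
def ipow (I : Ideal A) (t : ℤ) : Ideal A := I ^ t.toNat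

variable (I J : Ideal A) (k : ℕ) (r s : ℤ)

/-- The ideal `I^(r+ik) J^(s+ik)`. -/
def deg (i : ℕ) : Ideal A := ipow I (r + i * k) * ipow J (s + i * k)

/-- The `i`-th term `(A / I^(r+ik) J^(s+ik))^(binom n i)` of the complex `C•(n,k,r,s)`,
realized as functions on the `i`-element subsets of `Fin n`. -/
abbrev Cterm (n : ℕ) (i : ℕ) : Type _ :=
  {T : Finset (Fin n) // T.card = i} → A ⧸ deg I J k r s i

variable {n : ℕ} (y : Fin n → A)

/-- Multiplication by `(y j)^k` from `A/I^(r+ik)J^(s+ik)` to `A/I^(r+(i+1)k)J^(s+(i+1)k)`,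
well defined since `y j ∈ IJ`. -/
def mulQ (hy : ∀ j, y j ∈ I * J) (j : Fin n) (i : ℕ) :
    (A ⧸ deg I J k r s i) →ₗ[A] A ⧸ deg I J k r s (i + 1) :=
  Submodule.mapQ _ _ (LinearMap.lsmul A A ((y j) ^ k)) (by
    intro x hx
    simp only [Submodule.mem_comap, LinearMap.lsmul_apply, smul_eq_mul]
    have h1 : (y j) ^ k ∈ I ^ k * J ^ k := by
      have h := Ideal.pow_mem_pow (hy j) k
      rwa [mul_pow] at h
    have h2 : (y j) ^ k * x ∈ (I ^ k * J ^ k) * deg I J k r s i :=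
      Ideal.mul_mem_mul h1 hx
    refine SetLike.le_def.mp ?_ h2
    unfold deg ipow
    rw [mul_mul_mul_comm, ← pow_add, ← pow_add]
    refine Ideal.mul_mono (Ideal.pow_le_pow_right ?_) (Ideal.pow_le_pow_right ?_) <;>
      · push_cast
        rw [add_mul, one_mul, ← add_assoc]
        omega)

/-- The Koszul-type differential of the complex `C•(n,k,r,s)`. -/
def diff (hy : ∀ j, y j ∈ I * J) (i : ℕ) :
    Cterm I J k r s n i →ₗ[A] Cterm I J k r s n (i + 1) :=
  LinearMap.pi fun T =>
    ∑ j ∈ T.1.attach,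
      ((-1 : ℤ) ^ (T.1.filter (fun a => a < j.1)).card) •
        ((mulQ I J k r s y hy j.1 i).comp
          (LinearMap.proj (⟨T.1.erase j.1, by
            rw [Finset.card_erase_of_mem j.2, T.2]; omega⟩ :
              {T' : Finset (Fin n) // T'.card = i})))

/-- The boundaries of the complex `C•(n,k,r,s)`. -/
def bdry (hy : ∀ j, y j ∈ I * J) : ∀ i : ℕ, Submodule A (Cterm I J k r s n i)
  | 0 => ⊥
  | (i + 1) => LinearMap.range (diff I J k r s y hy i)

/-- The `i`-th cohomology of the complex `C•(n,k,r,s)`. -/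
abbrev cohomology (hy : ∀ j, y j ∈ I * J) (i : ℕ) :=
  ↥(LinearMap.ker (diff I J k r s y hy i)) ⧸
    Submodule.comap (LinearMap.ker (diff I J k r s y hy i)).subtype
      (bdry I J k r s y hy i)

end KirbyMehran

open KirbyMehran

/-- An ideal is `m`-primary: it is contained in the maximal ideal and contains a
power of it. -/
def IsMPrimary {A : Type*} [CommRing A] [IsLocalRing A] (I : Ideal A) : Prop :=
  I ≤ IsLocalRing.maximalIdeal A ∧ ∃ n : ℕ, (IsLocalRing.maximalIdeal A) ^ n ≤ I

section Aux
open RingTheory.Sequence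
open scoped Pointwise

theorem wr_ext {R : Type*} [CommRing R] (rs : List R) : ∀ {M' M M'' : Type _}
    [AddCommGroup M'] [AddCommGroup M] [AddCommGroup M''] [Module R M'] [Module R M] [Module R M'']
    (f : M' →ₗ[R] M) (g : M →ₗ[R] M'') (_ : Function.Injective f) (_ : Function.Surjective g)
    (_ : Function.Exact f g) (_ : IsWeaklyRegular M' rs) (_ : IsWeaklyRegular M'' rs),
    IsWeaklyRegular M rs := by
  induction rs with
  | nil => intros; exact IsWeaklyRegular.nil R _
  | cons r rs ih =>
    intro M' M M'' _ _ _ _ _ _ f g hf hg hfg h1 h2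
    rw [isWeaklyRegular_cons_iff] at h1 h2 ⊢
    refine ⟨?_, ih (QuotSMulTop.map r f) (QuotSMulTop.map r g) ?_
      (QuotSMulTop.map_surjective r hg) (QuotSMulTop.map_exact r hfg hg) h1.2 h2.2⟩
    · rw [isSMulRegular_iff_right_eq_zero_of_smul]
      intro x hx
      have : g x = 0 := by
        apply (isSMulRegular_iff_right_eq_zero_of_smul).1 h2.1
        rw [← map_smul, hx, map_zero]
      obtain ⟨x', rfl⟩ := (hfg x).1 this
      rw [← map_smul] at hx
      have hx' := hf (hx.trans (map_zero f).symm)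
      rw [(isSMulRegular_iff_right_eq_zero_of_smul).1 h1.1 _ hx', map_zero]
    · rw [injective_iff_map_eq_zero]
      intro x
      obtain ⟨x, rfl⟩ := Submodule.Quotient.mk_surjective _ x
      intro hx
      rw [QuotSMulTop.map_apply_mk, Submodule.Quotient.mk_eq_zero,
        Submodule.mem_smul_pointwise_iff_exists] at hx
      obtain ⟨w, -, hw⟩ := hx
      have : g w = 0 := by
        apply (isSMulRegular_iff_right_eq_zero_of_smul).1 h2.1
        rw [← map_smul, hw, hfg.apply_apply_eq_zero]
      obtain ⟨w', rfl⟩ := (hfg w).1 this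
      rw [← map_smul] at hw
      rw [← hf hw, Submodule.Quotient.mk_eq_zero]
      exact Submodule.smul_mem_pointwise_smul _ _ _ trivial

theorem wr_quot_pow {R : Type*} [CommRing R] (rs : List R) {M : Type*} [AddCommGroup M] [Module R M]
    (r : R) (hr : IsSMulRegular M r) (h : IsWeaklyRegular (QuotSMulTop r M) rs) (k : ℕ)
    (hk : 1 ≤ k) : IsWeaklyRegular (QuotSMulTop (r ^ k) M) rs := by
  induction k, hk using Nat.le_induction with
  | base => rwa [pow_one]
  | succ k hk ih =>
    have h1 : r ^ k • (⊤ : Submodule R M) ≤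
        (r ^ (k+1) • (⊤ : Submodule R M)).comap (LinearMap.lsmul R M r) := by
      intro x hx
      obtain ⟨w, -, rfl⟩ := (Submodule.mem_smul_pointwise_iff_exists _ _ _).1 hx
      rw [Submodule.mem_comap, LinearMap.lsmul_apply, smul_smul, ← pow_succ']
      exact Submodule.smul_mem_pointwise_smul _ _ _ trivial
    have h2 : r ^ (k+1) • (⊤ : Submodule R M) ≤ r • (⊤ : Submodule R M) := by
      intro x hx
      obtain ⟨w, -, rfl⟩ := (Submodule.mem_smul_pointwise_iff_exists _ _ _).1 hx
      rw [pow_succ', mul_smul]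
      exact Submodule.smul_mem_pointwise_smul _ _ _ trivial
    refine wr_ext rs (Submodule.mapQ _ _ (LinearMap.lsmul R M r) h1)
      (Submodule.factor h2) ?_ (Submodule.factor_surjective h2) ?_ ih h
    · rw [injective_iff_map_eq_zero]
      intro x
      obtain ⟨x, rfl⟩ := Submodule.Quotient.mk_surjective _ x
      intro hx
      rw [Submodule.mapQ_apply, Submodule.Quotient.mk_eq_zero,
        Submodule.mem_smul_pointwise_iff_exists] at hx
      obtain ⟨w, -, hw⟩ := hx
      rw [pow_succ', mul_smul, LinearMap.lsmul_apply] at hw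
      rw [← hr hw, Submodule.Quotient.mk_eq_zero]
      exact Submodule.smul_mem_pointwise_smul _ _ _ trivial
    · intro x
      obtain ⟨x, rfl⟩ := Submodule.Quotient.mk_surjective _ x
      constructor
      · intro hx
        have hx' : x ∈ r • (⊤ : Submodule R M) := (Submodule.Quotient.mk_eq_zero _).1 hx
        obtain ⟨w, -, rfl⟩ := (Submodule.mem_smul_pointwise_iff_exists _ _ _).1 hx'
        exact ⟨Submodule.Quotient.mk w, rfl⟩
      · rintro ⟨w, hw⟩
        obtain ⟨w, rfl⟩ := Submodule.Quotient.mk_surjective _ w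
        rw [← hw]
        refine (Submodule.Quotient.mk_eq_zero _).2 ?_
        exact Submodule.smul_mem_pointwise_smul _ _ _ trivial

theorem wr_pow {R : Type*} [CommRing R] (k : ℕ) (hk : 1 ≤ k) (rs : List R) :
    ∀ {M : Type _} [AddCommGroup M] [Module R M], IsWeaklyRegular M rs →
    IsWeaklyRegular M (rs.map (· ^ k)) := by
  induction rs with
  | nil => intros; exact IsWeaklyRegular.nil R _
  | cons r rs ih =>
    intro M _ _ h
    rw [isWeaklyRegular_cons_iff] at h
    rw [List.map_cons, isWeaklyRegular_cons_iff]
    exact ⟨h.1.pow k, ih (wr_quot_pow rs r h.1 h.2 k hk)⟩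

theorem sum_alt {M : Type*} [AddCommGroup M] (n : ℕ) (a : Fin n → Fin n → M)
    (h0 : ∀ i, a i i = 0) (h1 : ∀ i j, a i j = - a j i) : ∑ i, ∑ j, a i j = 0 := by
  rw [← Finset.sum_product']
  refine Finset.sum_involution (fun p _ => (p.2, p.1)) ?_ ?_ ?_ ?_
  · rintro ⟨i, j⟩ _
    simp [h1 i j]
  · rintro ⟨i, j⟩ _ h h'
    simp only [Prod.mk.injEq] at h'
    apply h
    simp [h'.1, h0]
  · simp
  · simp

theorem syz {R : Type*} [CommRing R] (n : ℕ) : ∀ (z : Fin n → R) {M : Type _}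
    [AddCommGroup M] [Module R M], IsWeaklyRegular M (List.ofFn z) →
    ∀ c : Fin n → M, ∑ j, z j • c j = 0 → ∃ a : Fin n → Fin n → M, (∀ i, a i i = 0) ∧
      (∀ i j, a i j = - a j i) ∧ ∀ i, c i = ∑ j, z j • a i j := by
  induction n with
  | zero => intro z M _ _ _ c _; exact ⟨fun i => i.elim0, fun i => i.elim0, fun i => i.elim0, fun i => i.elim0⟩
  | succ n ih =>
    intro z M _ _ hz c hc
    rw [List.ofFn_succ, isWeaklyRegular_cons_iff] at hz
    obtain ⟨hz0, hz⟩ := hz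
    rw [Fin.sum_univ_succ] at hc
    let π : M →ₗ[R] QuotSMulTop (z 0) M := Submodule.mkQ _
    have hπ : ∀ x, π x = 0 → ∃ w, x = z 0 • w := by
      intro x hx
      have hx' : x ∈ z 0 • (⊤ : Submodule R M) := (Submodule.Quotient.mk_eq_zero _).1 hx
      obtain ⟨w, -, rfl⟩ := (Submodule.mem_smul_pointwise_iff_exists _ _ _).1 hx'
      exact ⟨w, rfl⟩
    have hπ0 : ∀ x, π (z 0 • x) = 0 := by
      intro x
      refine (Submodule.Quotient.mk_eq_zero _).2 ?_
      exact Submodule.smul_mem_pointwise_smul _ _ _ trivial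
    obtain ⟨a', ha0, ha1, ha⟩ := ih (fun j => z j.succ) hz (fun j => π (c j.succ)) (by
      have := congrArg π hc
      rw [map_add, hπ0, zero_add, map_zero, map_sum] at this
      simpa using this)
    have hsurj : ∀ i j, ∃ x, π x = a' i j := fun i j => Submodule.mkQ_surjective _ _
    choose a'' ha'' using hsurj
    let a : Fin n → Fin n → M := fun i j => if i < j then a'' i j else if j < i then - a'' j i else 0
    have hb0 : ∀ i, a i i = 0 := fun i => by simp [a]
    have hb1 : ∀ i j, a i j = - a j i := fun i j => by
      rcases lt_trichotomy i j with h | h | h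
      · simp [a, h, h.not_gt]
      · subst h; simp [a]
      · simp [a, h, h.not_gt]
    have hb : ∀ i j, π (a i j) = a' i j := fun i j => by
      rcases lt_trichotomy i j with h | h | h
      · simp [a, h, ha'']
      · subst h; simp [a, ha0]
      · simp [a, h, h.not_gt, ha'', ha1 i j]
    have hex : ∀ i : Fin n, ∃ w, c i.succ - ∑ j : Fin n, z j.succ • a i j = z 0 • w := by
      intro i
      apply hπ
      rw [map_sub, ha i, map_sum, sub_eq_zero]
      exact Finset.sum_congr rfl fun j _ => by rw [map_smul, hb]
    choose b hbb using hex
    have hb' : ∀ i : Fin n, c i.succ = z 0 • b i + ∑ j : Fin n, z j.succ • a i j := fun i => by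
      rw [← hbb i]; abel
    have hc0 : c 0 + ∑ j : Fin n, z j.succ • b j = 0 := by
      apply (isSMulRegular_iff_right_eq_zero_of_smul).1 hz0
      have hs : ∑ i : Fin n, ∑ j : Fin n, z i.succ • z j.succ • a i j = 0 := by
        apply sum_alt
        · intro i; simp [hb0]
        · intro i j; rw [hb1 i j, smul_neg, smul_neg, smul_comm]
      rw [← hc, smul_add, Finset.smul_sum]
      congr 1
      simp_rw [hb', smul_add, Finset.sum_add_distrib, Finset.smul_sum]
      rw [hs, add_zero]
      exact Finset.sum_congr rfl fun j _ => smul_comm _ _ _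
    refine ⟨Fin.cons (Fin.cons 0 (fun j => - b j)) (fun i => Fin.cons (b i) (a i)), ?_, ?_, ?_⟩
    · intro i; refine Fin.cases ?_ ?_ i <;> simp [hb0]
    · intro i j
      refine Fin.cases ?_ (fun i => ?_) i <;> refine Fin.cases ?_ (fun j => ?_) j <;> simp
      exact hb1 i j
    · intro i; refine Fin.cases ?_ (fun i => ?_) i
      · simp [Fin.sum_univ_succ]
        exact eq_neg_of_add_eq_zero_left hc0
      · simp [Fin.sum_univ_succ, hb']
end Aux

section Aux2
open RingTheory.Sequence

/-- Koszul sign for the ordered pair `(j,l)`. -/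
def ksgn {n : ℕ} (A : Type*) [CommRing A] (j l : Fin n) : A :=
  (-1) ^ (((Finset.univ : Finset (Fin n)).filter (· < j)).card) *
    (-1) ^ (((Finset.univ.erase j).filter (· < l)).card)

theorem card_filter_erase {n : ℕ} (j l : Fin n) :
    (((Finset.univ.erase j).filter (· < l)).card) = if j < l then l.1 - 1 else l.1 := by
  have h : (Finset.univ.erase j).filter (· < l) = (Finset.univ.filter (· < l)).erase j := by
    ext x; simp [and_comm]
  have h2 : (Finset.univ.filter (· < l)) = Finset.Iio l := by ext; simp
  rw [h, h2]
  split_ifs with hj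
  · rw [Finset.card_erase_of_mem (by simpa using hj), Fin.card_Iio]
  · rw [Finset.erase_eq_of_notMem (by simpa using hj), Fin.card_Iio]

theorem ksgn_anti {n : ℕ} (A : Type*) [CommRing A] (j l : Fin n) (h : j ≠ l) :
    ksgn A j l = - ksgn A l j := by
  have h2 : ∀ l : Fin n, (Finset.univ.filter (· < l)).card = l.1 := by
    intro l
    have : (Finset.univ.filter (· < l)) = Finset.Iio l := by ext; simp
    rw [this, Fin.card_Iio]
  unfold ksgn
  rw [card_filter_erase, card_filter_erase, h2, h2]
  rcases lt_or_gt_of_ne h with h | h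
  · rw [if_pos h, if_neg h.not_gt]
    obtain ⟨l, hl⟩ := l
    obtain _ | l := l
    · exact absurd h (by simp [Fin.lt_def])
    · simp only [Nat.add_sub_cancel]; ring
  · rw [if_neg h.not_gt, if_pos h]
    obtain ⟨j, hj⟩ := j
    obtain _ | j := j
    · exact absurd h (by simp [Fin.lt_def])
    · simp only [Nat.add_sub_cancel]; ring

theorem neg_one_pow_sq {A : Type*} [CommRing A] (e : ℕ) : ((-1 : A) ^ e) * (-1) ^ e = 1 := by
  rw [← mul_pow]; simp

theorem ksgn_sq {n : ℕ} (A : Type*) [CommRing A] (j l : Fin n) :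
    ksgn A j l * ksgn A j l = 1 := by
  unfold ksgn
  rw [mul_mul_mul_comm, neg_one_pow_sq, neg_one_pow_sq, one_mul]

theorem exists_b {A : Type*} [CommRing A] {n : ℕ} (a : Fin n → Fin n → A)
    (ha : ∀ i j, a i j = - a j i) : ∃ b : Finset (Fin n) → A, ∀ j l, j ≠ l →
      b ((Finset.univ.erase j).erase l) = ksgn A j l * a j l := by
  have : ∀ S : Finset (Fin n), ∃ x : A, ∀ j l, j ≠ l → S = ((Finset.univ.erase j).erase l) →
      x = ksgn A j l * a j l := by
    intro S
    by_cases h : ∃ j l, j ≠ l ∧ S = ((Finset.univ.erase j).erase l)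
    · obtain ⟨j, l, hjl, rfl⟩ := h
      refine ⟨ksgn A j l * a j l, fun j' l' hjl' hS => ?_⟩
      have h1 : ∀ x, (x = l ∨ x = j) ↔ (x = l' ∨ x = j') := by
        intro x
        have := congrArg (x ∈ ·) hS
        simp at this
        tauto
      have hj := (h1 j).1 (Or.inr rfl)
      have hl := (h1 l).1 (Or.inl rfl)
      rcases hj with rfl | rfl
      · rcases hl with rfl | rfl
        · exact absurd rfl hjl
        · rw [ksgn_anti A _ _ hjl, ha j l]; ring
      · rcases hl with rfl | rfl
        · rfl
        · exact absurd rfl hjl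
    · refine ⟨0, fun j l hjl hS => absurd ⟨j, l, hjl, hS⟩ h⟩
  choose b hb using this
  exact ⟨b, fun j l h => hb _ j l h rfl⟩

variable {A : Type*} [CommRing A] (I J : Ideal A) (k : ℕ) (r s : ℤ) {n : ℕ} (y : Fin n → A)

/-- Class in the complex of a function on all subsets. -/
def cmk (n i : ℕ) : (Finset (Fin n) → A) →ₗ[A] Cterm I J k r s n i :=
  LinearMap.pi fun T => (Submodule.mkQ (deg I J k r s i)).comp (LinearMap.proj T.1)

theorem cmk_apply (n i : ℕ) (c : Finset (Fin n) → A) (T) :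
    cmk I J k r s n i c T = Submodule.Quotient.mk (c T.1) := rfl

theorem cmk_surj (n i : ℕ) : Function.Surjective (cmk I J k r s n i) := by
  intro x
  choose c hc using fun T => Submodule.Quotient.mk_surjective (deg I J k r s i) (x T)
  refine ⟨fun S => if h : S.card = i then c ⟨S, h⟩ else 0, ?_⟩
  funext T
  rw [cmk_apply, dif_pos T.2]
  exact hc T

theorem diff_cmk (hy : ∀ j, y j ∈ I * J) (i : ℕ) (c : Finset (Fin n) → A)
    (T : {T : Finset (Fin n) // T.card = i + 1}) :
    KirbyMehran.diff I J k r s y hy i (cmk I J k r s n i c) T =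
      Submodule.Quotient.mk (∑ j ∈ T.1, (-1) ^ ((T.1.filter (· < j)).card) *
        (y j ^ k * c (T.1.erase j))) := by
  rw [← Finset.sum_attach]
  rw [← Submodule.mkQ_apply, map_sum]
  unfold KirbyMehran.diff
  rw [LinearMap.pi_apply, LinearMap.sum_apply]
  refine Finset.sum_congr rfl fun j _ => ?_
  rw [LinearMap.smul_apply, LinearMap.comp_apply, LinearMap.proj_apply, cmk_apply]
  have : mulQ I J k r s y hy j.1 i (Submodule.Quotient.mk (c (T.1.erase j.1))) =
    Submodule.mkQ (deg I J k r s (i+1)) (y j.1 ^ k * c (T.1.erase j.1)) := rfl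
  rw [this, ← map_zsmul, zsmul_eq_mul]
  push_cast
  rfl

/-- Last Koszul differential. -/
def kphi (z : Fin n → A) : (Finset (Fin n) → A) →ₗ[A] A where
  toFun c := ∑ j, (-1) ^ ((Finset.univ.filter (· < j)).card) * (z j * c (Finset.univ.erase j))
  map_add' c d := by
    rw [← Finset.sum_add_distrib]
    exact Finset.sum_congr rfl fun j _ => by simp only [Pi.add_apply]; ring
  map_smul' a c := by
    simp only [RingHom.id_apply, smul_eq_mul, Finset.mul_sum]
    exact Finset.sum_congr rfl fun j _ => by simp only [Pi.smul_apply, smul_eq_mul]; ring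

theorem kphi_apply (z : Fin n → A) (c : Finset (Fin n) → A) : kphi z c =
    ∑ j, (-1) ^ ((Finset.univ.filter (· < j)).card) * (z j * c (Finset.univ.erase j)) := rfl

theorem mem_span_mul (z : Fin n → A) (D : Ideal A) (x : A) :
    x ∈ Ideal.span (Set.range z) * D ↔ ∃ d : Fin n → A, (∀ j, d j ∈ D) ∧ x = ∑ j, z j * d j := by
  constructor
  · intro h
    induction h using Submodule.mul_induction_on' with
    | mem_mul_mem u hu v hv =>
      obtain ⟨e, rfl⟩ := Ideal.mem_span_range_iff_exists_fun.1 hu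
      refine ⟨fun j => e j * v, fun j => D.mul_mem_left _ hv, ?_⟩
      rw [Finset.sum_mul]
      exact Finset.sum_congr rfl fun j _ => by ring
    | add u _ v _ hu hv =>
      obtain ⟨d, hd, rfl⟩ := hu
      obtain ⟨e, he, rfl⟩ := hv
      refine ⟨fun j => d j + e j, fun j => D.add_mem (hd j) (he j), ?_⟩
      rw [← Finset.sum_add_distrib]
      exact Finset.sum_congr rfl fun j _ => by ring
  · rintro ⟨d, hd, rfl⟩
    exact Ideal.sum_mem _ fun j _ => Ideal.mul_mem_mul (Ideal.subset_span ⟨j, rfl⟩) (hd j)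

/-- If a cochain is congruent to a boundary, its image under the last differential. -/
theorem kphi_of_cong (z : Fin n → A) (D : Ideal A) (b c : Finset (Fin n) → A)
    (h : ∀ j, c (Finset.univ.erase j) - ∑ l ∈ Finset.univ.erase j,
      (-1) ^ (((Finset.univ.erase j).filter (· < l)).card) *
        (z l * b ((Finset.univ.erase j).erase l)) ∈ D) :
    kphi z c ∈ Ideal.span (Set.range z) * D := by
  rw [mem_span_mul]
  refine ⟨fun j => (-1) ^ ((Finset.univ.filter (· < j)).card) * _,
    fun j => D.mul_mem_left _ (h j), ?_⟩
  have h0 : ∑ j, ∑ l, (if j = l then 0 else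
      ksgn A j l * (z j * (z l * b ((Finset.univ.erase j).erase l)))) = 0 := by
    apply sum_alt
    · intro i; simp
    · intro i j
      by_cases hij : i = j
      · simp [hij]
      · rw [if_neg hij, if_neg (Ne.symm hij), ksgn_anti A i j hij, Finset.erase_right_comm]
        ring
  rw [kphi_apply, ← sub_eq_zero, ← Finset.sum_sub_distrib, ← h0]
  refine Finset.sum_congr rfl fun j _ => ?_
  have h1 : ∑ l, (if j = l then 0 else
      ksgn A j l * (z j * (z l * b ((Finset.univ.erase j).erase l)))) =
      (-1) ^ ((Finset.univ.filter (· < j)).card) * z j * ∑ l ∈ Finset.univ.erase j,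
      (-1) ^ (((Finset.univ.erase j).filter (· < l)).card) *
        (z l * b ((Finset.univ.erase j).erase l)) := by
    rw [← Finset.add_sum_erase _ _ (Finset.mem_univ j), if_pos rfl, zero_add, Finset.mul_sum]
    refine Finset.sum_congr rfl fun l hl => ?_
    rw [if_neg (Finset.ne_of_mem_erase hl).symm, ksgn]
    ring
  rw [h1]
  ring

theorem cong_of_kphi (z : Fin n → A) (hz : IsWeaklyRegular A (List.ofFn z))
    (D : Ideal A) (c : Finset (Fin n) → A)
    (h : kphi z c ∈ Ideal.span (Set.range z) * D) :
    ∃ b : Finset (Fin n) → A, ∀ j, c (Finset.univ.erase j) - ∑ l ∈ Finset.univ.erase j,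
      (-1) ^ (((Finset.univ.erase j).filter (· < l)).card) *
        (z l * b ((Finset.univ.erase j).erase l)) ∈ D := by
  obtain ⟨d, hd, hcd⟩ := (mem_span_mul z D _).1 h
  obtain ⟨a, ha0, ha1, ha⟩ := syz n z hz
    (fun j => (-1) ^ ((Finset.univ.filter (· < j)).card) * c (Finset.univ.erase j) - d j) (by
      rw [kphi_apply, ← sub_eq_zero, ← Finset.sum_sub_distrib] at hcd
      rw [← hcd]
      exact Finset.sum_congr rfl fun j _ => by rw [smul_eq_mul]; ring)
  obtain ⟨b, hb⟩ := exists_b a ha1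
  refine ⟨b, fun j => ?_⟩
  have h1 : ∑ l ∈ Finset.univ.erase j,
      (-1) ^ (((Finset.univ.erase j).filter (· < l)).card) *
        (z l * b ((Finset.univ.erase j).erase l)) =
      (-1) ^ ((Finset.univ.filter (· < j)).card) * ∑ l, z l • a j l := by
    rw [← Finset.add_sum_erase _ _ (Finset.mem_univ j), ha0, smul_zero, zero_add, Finset.mul_sum]
    refine Finset.sum_congr rfl fun l hl => ?_
    rw [hb j l (Finset.ne_of_mem_erase hl).symm, ksgn, smul_eq_mul]
    linear_combination ((-1) ^ ((Finset.univ.filter (· < j)).card) * z l * a j l) *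
      neg_one_pow_sq (A := A) (((Finset.univ.erase j).filter (· < l)).card)
  rw [h1, ← ha j]
  have h2 := neg_one_pow_sq (A := A) ((Finset.univ.filter (· < j)).card)
  have h3 := D.mul_mem_left ((-1) ^ ((Finset.univ.filter (· < j)).card)) (hd j)
  convert h3 using 1
  linear_combination (- c (Finset.univ.erase j)) * h2

theorem exists_erase {m : ℕ} (T : Finset (Fin (m + 1))) (hT : T.card = m) :
    ∃ j, T = Finset.univ.erase j := by
  have h : Tᶜ.card = 1 := by rw [Finset.card_compl, hT, Fintype.card_fin]; omega
  obtain ⟨j, hj⟩ := Finset.card_eq_one.1 h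
  refine ⟨j, ?_⟩
  rw [← compl_compl T, hj]
  ext x; simp

theorem mem_bdry_iff {m : ℕ} (y : Fin (m + 1) → A) (hy : ∀ j, y j ∈ I * J)
    (hz : IsWeaklyRegular A (List.ofFn fun j => y j ^ k)) (c : Finset (Fin (m + 1)) → A) :
    cmk I J k r s (m + 1) m c ∈ bdry I J k r s y hy m ↔
      kphi (fun j => y j ^ k) c ∈ Ideal.span (Set.range fun j => y j ^ k) * deg I J k r s m := by
  have key : cmk I J k r s (m + 1) m c ∈ bdry I J k r s y hy m ↔
      ∃ b : Finset (Fin (m + 1)) → A, ∀ j, c (Finset.univ.erase j) - ∑ l ∈ Finset.univ.erase j,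
      (-1) ^ (((Finset.univ.erase j).filter (· < l)).card) *
        (y l ^ k * b ((Finset.univ.erase j).erase l)) ∈ deg I J k r s m := by
    obtain _ | m := m
    · rw [bdry, Submodule.mem_bot]
      constructor
      · intro h
        refine ⟨0, fun j => ?_⟩
        have := congrFun h ⟨Finset.univ.erase j, by
          rw [Finset.card_erase_of_mem (Finset.mem_univ j), Finset.card_univ, Fintype.card_fin]⟩
        rw [cmk_apply, Pi.zero_apply, Submodule.Quotient.mk_eq_zero] at this
        simpa using this
      · rintro ⟨b, hb⟩
        funext T
        obtain ⟨T, hT⟩ := T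
        obtain ⟨j, rfl⟩ := exists_erase T hT
        rw [cmk_apply, Pi.zero_apply, Submodule.Quotient.mk_eq_zero]
        have := hb j
        have he : Finset.univ.erase j = ∅ := Finset.card_eq_zero.1 hT
        rw [he, Finset.sum_empty, sub_zero] at this
        change c (Finset.univ.erase j) ∈ _
        rwa [he]
    · rw [bdry, LinearMap.mem_range]
      constructor
      · rintro ⟨x, hx⟩
        obtain ⟨b, rfl⟩ := cmk_surj I J k r s _ _ x
        refine ⟨b, fun j => ?_⟩
        have := congrFun hx ⟨Finset.univ.erase j, by simp⟩
        rw [diff_cmk, cmk_apply] at this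
        exact (Submodule.Quotient.eq _).1 this.symm
      · rintro ⟨b, hb⟩
        refine ⟨cmk I J k r s _ _ b, ?_⟩
        funext T
        obtain ⟨T, hT⟩ := T
        obtain ⟨j, rfl⟩ := exists_erase T hT
        rw [diff_cmk, cmk_apply]
        exact ((Submodule.Quotient.eq _).2 (hb j)).symm
  rw [key]
  exact ⟨fun ⟨b, hb⟩ => kphi_of_cong _ _ b c hb, fun h => cong_of_kphi _ hz _ c h⟩

theorem cmk_mem_ker_iff {m : ℕ} (y : Fin (m + 1) → A) (hy : ∀ j, y j ∈ I * J)
    (c : Finset (Fin (m + 1)) → A) :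
    cmk I J k r s (m + 1) m c ∈ LinearMap.ker (KirbyMehran.diff I J k r s y hy m) ↔
      kphi (fun j => y j ^ k) c ∈ deg I J k r s (m + 1) := by
  rw [LinearMap.mem_ker]
  constructor
  · intro h
    have := congrFun h ⟨Finset.univ, by simp⟩
    rw [diff_cmk, Pi.zero_apply, Submodule.Quotient.mk_eq_zero] at this
    exact this
  · intro h
    funext T
    obtain ⟨T, hT⟩ := T
    have : T = Finset.univ := (Finset.card_eq_iff_eq_univ T).1 (by simpa using hT)
    subst this
    rw [diff_cmk, Pi.zero_apply, Submodule.Quotient.mk_eq_zero]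
    exact h

theorem kphi_mem_span (z : Fin n → A) (c : Finset (Fin n) → A) :
    kphi z c ∈ Ideal.span (Set.range z) := by
  rw [kphi_apply]
  exact Ideal.sum_mem _ fun j _ => Ideal.mul_mem_left _ _ <|
    Ideal.mul_mem_right _ _ (Ideal.subset_span ⟨j, rfl⟩)

theorem exists_kphi (z : Fin n → A) (x : A) (hx : x ∈ Ideal.span (Set.range z)) :
    ∃ c, kphi z c = x := by
  obtain ⟨e, rfl⟩ := Ideal.mem_span_range_iff_exists_fun.1 hx
  have h : ∀ S : Finset (Fin n), ∃ x : A, ∀ j, S = Finset.univ.erase j →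
      x = (-1) ^ ((Finset.univ.filter (· < j)).card) * e j := by
    intro S
    by_cases h : ∃ j, S = Finset.univ.erase j
    · obtain ⟨j, rfl⟩ := h
      refine ⟨(-1) ^ ((Finset.univ.filter (· < j)).card) * e j, fun j' h => ?_⟩
      have : j = j' := by
        have := congrArg (j ∈ ·) h
        simpa using this
      subst this
      rfl
    · exact ⟨0, fun j hj => absurd ⟨j, hj⟩ h⟩
  choose c hc using h
  refine ⟨c, ?_⟩
  rw [kphi_apply]
  refine Finset.sum_congr rfl fun j _ => ?_
  rw [hc _ j rfl]
  linear_combination (z j * e j) * neg_one_pow_sq (A := A) ((Finset.univ.filter (· < j)).card)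

end Aux2

/-- For `m`-primary ideals `I, J` of a Noetherian local ring `(A,m)`
and an `A`-regular sequence `y_1, …, y_n ∈ IJ`, the `(n-1)`-st cohomology of the
complex `C•(n,k,r,s)` is isomorphic to
`((y_1^k,…,y_n^k) ∩ I^(r+nk) J^(s+nk)) / ((y_1^k,…,y_n^k) · I^(r+(n-1)k) J^(s+(n-1)k))`. -/
theorem kirbyMehran_Hn_sub_one {A : Type*} [CommRing A] [IsNoetherianRing A] [IsLocalRing A]
    (I J : Ideal A) (hI : IsMPrimary I) (hJ : IsMPrimary J)
    (n k : ℕ) (hn : 0 < n) (hk : 1 ≤ k) (r s : ℤ) (y : Fin n → A)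
    (hy : ∀ j, y j ∈ I * J)
    (hreg : RingTheory.Sequence.IsRegular A (List.ofFn y)) :
    Nonempty (cohomology I J k r s y hy (n - 1) ≃ₗ[A]
      ↥(Ideal.span (Set.range fun j => (y j) ^ k) ⊓ deg I J k r s n) ⧸
        Submodule.comap
          (Ideal.span (Set.range fun j => (y j) ^ k) ⊓ deg I J k r s n).subtype
          (Ideal.span (Set.range fun j => (y j) ^ k) * deg I J k r s (n - 1))) := by
  obtain ⟨m, rfl⟩ : ∃ m, n = m + 1 := ⟨n - 1, by omega⟩
  have hz : RingTheory.Sequence.IsWeaklyRegular A (List.ofFn fun j => y j ^ k) := by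
    have := wr_pow k hk _ hreg.toIsWeaklyRegular
    rwa [List.map_ofFn] at this
  change Nonempty (cohomology I J k r s y hy m ≃ₗ[A]
      ↥(Ideal.span (Set.range fun j => (y j) ^ k) ⊓ deg I J k r s (m + 1)) ⧸
        Submodule.comap
          (Ideal.span (Set.range fun j => (y j) ^ k) ⊓ deg I J k r s (m + 1)).subtype
          (Ideal.span (Set.range fun j => (y j) ^ k) * deg I J k r s m))
  let N : Submodule A (Finset (Fin (m + 1)) → A) :=
    Submodule.comap (kphi fun j => y j ^ k) (deg I J k r s (m + 1))
  let f₀ : N →ₗ[A] LinearMap.ker (KirbyMehran.diff I J k r s y hy m) :=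
    ((cmk I J k r s (m + 1) m).comp N.subtype).codRestrict _
      fun c => (cmk_mem_ker_iff I J k r s y hy c.1).2 c.2
  let g₀ : N →ₗ[A] ↥(Ideal.span (Set.range fun j => (y j) ^ k) ⊓ deg I J k r s (m + 1)) :=
    ((kphi fun j => y j ^ k).comp N.subtype).codRestrict _
      fun c => ⟨kphi_mem_span _ _, c.2⟩
  have hf₀ : Function.Surjective f₀ := by
    rintro ⟨x, hx⟩
    obtain ⟨c, rfl⟩ := cmk_surj I J k r s _ _ x
    exact ⟨⟨c, (cmk_mem_ker_iff I J k r s y hy c).1 hx⟩, rfl⟩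
  have hg₀ : Function.Surjective g₀ := by
    rintro ⟨x, hx⟩
    obtain ⟨c, rfl⟩ := exists_kphi _ x hx.1
    exact ⟨⟨c, hx.2⟩, rfl⟩
  let f := (Submodule.mkQ (Submodule.comap
    (LinearMap.ker (KirbyMehran.diff I J k r s y hy m)).subtype
      (bdry I J k r s y hy m))).comp f₀
  let g := (Submodule.mkQ (Submodule.comap
          (Ideal.span (Set.range fun j => (y j) ^ k) ⊓ deg I J k r s (m + 1)).subtype
          (Ideal.span (Set.range fun j => (y j) ^ k) * deg I J k r s m))).comp g₀
  have hf : Function.Surjective f := (Submodule.mkQ_surjective _).comp hf₀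
  have hg : Function.Surjective g := (Submodule.mkQ_surjective _).comp hg₀
  have hfg : LinearMap.ker f = LinearMap.ker g := by
    ext c
    rw [LinearMap.mem_ker, LinearMap.mem_ker]
    refine (Submodule.Quotient.mk_eq_zero _).trans (Iff.trans ?_ (Submodule.Quotient.mk_eq_zero _).symm)
    exact mem_bdry_iff I J k r s y hy hz c.1
  exact ⟨(f.quotKerEquivOfSurjective hf).symm.trans
    ((Submodule.quotEquivOfEq _ _ hfg).trans (g.quotKerEquivOfSurjective hg))⟩
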